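/- Let q be an acyclic Boolean conjunctive query without self-join, τ a join tree for q, F, G ∈ q, z ∈ vars(q), and c a constant. Let q' = q[z→c], F' = F[z→c], G' = G[z→c], and let τ' be the tree obtained from τ by replacing each vertex H with H[z→c]. Then: (1) τ' is a join tree for q', so q' is acyclic; (2) if F' ↝ G' in the attack graph of τ', then F ↝ G in the attack graph of τ; (3) if F' ↝ G' in the attack graph of τ' and the attack F ↝ G in the attack graph of τ is weak, then the attack F' ↝ G' is weak (i.e., key(G') ⊆ F'^{⊕,q'}). -/

import Mathlib

attribute [local instance] Classical.propDecidable

noncomputable section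

/-- A term is either a variable (`Sum.inl v`) or a constant (`Sum.inr c`),
variables and constants both being coded by natural numbers
(the two copies of `ℕ` are disjoint). -/
abbrev Trm := ℕ ⊕ ℕ

/-- A database schema assigns to every relation name (a natural number) an
arity `n` and a primary-key length `k` with `n ≥ k ≥ 1`; the primary key
consists of the first `k` positions. -/
structure Schema where
  arity : ℕ → ℕ
  keyLen : ℕ → ℕ
  keyLen_le_arity : ∀ R, keyLen R ≤ arity R
  one_le_keyLen : ∀ R, 1 ≤ keyLen R

/-- An atom: a relation name together with a list of arguments. -/
structure Atom where
  rel : ℕ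
  args : List Trm
deriving DecidableEq

/-- Variables occurring in a list of terms. -/
def varsL (l : List Trm) : Finset ℕ := (l.filterMap Sum.getLeft?).toFinset

/-- Constants occurring in a list of terms. -/
def constsL (l : List Trm) : Finset ℕ := (l.filterMap Sum.getRight?).toFinset

/-- All variables of an atom. -/
def varsA (A : Atom) : Finset ℕ := varsL A.args

/-- Key variables of an atom: variables in the primary-key positions. -/
def keyVars (S : Schema) (A : Atom) : Finset ℕ := varsL (A.args.take (S.keyLen A.rel))

/-- Constants of an atom. -/
def constsA (A : Atom) : Finset ℕ := constsL A.args

/-- Well-formed atom: number of arguments equals the arity of its relation name. -/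
def wfAtom (S : Schema) (A : Atom) : Prop := A.args.length = S.arity A.rel

/-- A fact is an atom without variables. -/
def isFact (A : Atom) : Prop := ∀ t ∈ A.args, ∃ c : ℕ, t = Sum.inr c

/-- Two (facts) are key-equal: same relation name, and same primary-key positions. -/
def keyEqual (S : Schema) (A B : Atom) : Prop :=
  A.rel = B.rel ∧ A.args.take (S.keyLen A.rel) = B.args.take (S.keyLen B.rel)

/-- The block of `A` in `db`: all facts of `db` key-equal to `A`. -/
def block (S : Schema) (A : Atom) (db : Finset Atom) : Finset Atom :=
  db.filter (fun B => keyEqual S A B)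

/-- An uncertain database: a finite set of well-formed facts. -/
def IsDb (S : Schema) (db : Finset Atom) : Prop := ∀ A ∈ db, isFact A ∧ wfAtom S A

/-- A set of facts is consistent if it contains no two distinct key-equal facts. -/
def Consistent (S : Schema) (db : Finset Atom) : Prop :=
  ∀ A ∈ db, ∀ B ∈ db, keyEqual S A B → A = B

/-- A repair of `db`: a maximal consistent subset of `db`. -/
def IsRepair (S : Schema) (db r : Finset Atom) : Prop :=
  r ⊆ db ∧ Consistent S r ∧
    ∀ r' : Finset Atom, r ⊆ r' → r' ⊆ db → Consistent S r' → r' = r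

/-- Applying a valuation (a total map from variables to constants) to a term. -/
def appT (θ : ℕ → ℕ) : Trm → Trm
  | Sum.inl v => Sum.inr (θ v)
  | Sum.inr c => Sum.inr c

/-- Applying a valuation to an atom. -/
def appA (θ : ℕ → ℕ) (A : Atom) : Atom := ⟨A.rel, A.args.map (appT θ)⟩

/-- Applying a valuation to a query. -/
def appQ (θ : ℕ → ℕ) (q : Finset Atom) : Finset Atom := q.image (appA θ)

/-- `db ⊨ q`: some valuation sends every atom of `q` into `db`. -/
def Sat (db q : Finset Atom) : Prop := ∃ θ : ℕ → ℕ, appQ θ q ⊆ db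

/-- `db ∈ CERTAINTY(q)`: every repair of `db` satisfies `q`. -/
def Certainty (S : Schema) (q db : Finset Atom) : Prop :=
  ∀ r : Finset Atom, IsRepair S db r → Sat r q

/-- Variables of a query. -/
def varsQ (q : Finset Atom) : Finset ℕ := q.biUnion varsA

/-- Constants of a query. -/
def constsQ (q : Finset Atom) : Finset ℕ := q.biUnion constsA

/-- `q` has no self-join: no two distinct atoms share a relation name. -/
def NoSelfJoin (q : Finset Atom) : Prop := ∀ F ∈ q, ∀ G ∈ q, F.rel = G.rel → F = G

/-- `db` is purified relative to `q`. -/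
def Purified (q db : Finset Atom) : Prop :=
  ∀ A ∈ db, ∃ θ : ℕ → ℕ, A ∈ appQ θ q ∧ appQ θ q ⊆ db

/-- Active domain of a database: all constants occurring in its facts. -/
def adom (db : Finset Atom) : Finset ℕ := db.biUnion constsA

/-- Membership in the attribute closure of `X` under a set `FDs` of
functional dependencies (standard implication of functional dependencies). -/
inductive InCl (FDs : Set (Finset ℕ × Finset ℕ)) (X : Finset ℕ) : ℕ → Prop
  | base {x : ℕ} : x ∈ X → InCl FDs X x
  | step {Z W : Finset ℕ} {w : ℕ} : (Z, W) ∈ FDs → (∀ z ∈ Z, InCl FDs X z) →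
      w ∈ W → InCl FDs X w

/-- `FDs ⊨ X → Y`. -/
def FDImp (FDs : Set (Finset ℕ × Finset ℕ)) (X Y : Finset ℕ) : Prop :=
  ∀ y ∈ Y, InCl FDs X y

/-- `FD(q) = { key(F) → vars(F) : F ∈ q }`. -/
def FDq (S : Schema) (q : Finset Atom) : Set (Finset ℕ × Finset ℕ) :=
  {p | ∃ F ∈ q, p = (keyVars S F, varsA F)}

/-- `F^{+,q} = {x ∈ vars(q) : FD(q \ {F}) ⊨ key(F) → x}`. -/
def plusCl (S : Schema) (q : Finset Atom) (F : Atom) : Set ℕ :=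
  {x | x ∈ varsQ q ∧ InCl (FDq S (q.erase F)) (keyVars S F) x}

/-- `F^{⊕,q} = {x ∈ vars(q) : FD(q) ⊨ key(F) → x}`. -/
def oplusCl (S : Schema) (q : Finset Atom) (F : Atom) : Set ℕ :=
  {x | x ∈ varsQ q ∧ InCl (FDq S q) (keyVars S F) x}

/-- A (simple) path in an undirected graph given by edge relation `E`. -/
def IsPath (E : Atom → Atom → Prop) (p : List Atom) : Prop :=
  p ≠ [] ∧ p.Nodup ∧ List.Chain' E p

/-- `E` is (the edge relation of) a join tree for `q`: a tree (unique simple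
paths between any two vertices) on the atoms of `q` satisfying the
Connectedness Condition. -/
def IsJoinTree (q : Finset Atom) (E : Atom → Atom → Prop) : Prop :=
  (∀ a b, E a b → E b a) ∧
  (∀ a b, E a b → a ∈ q ∧ b ∈ q ∧ a ≠ b) ∧
  (∀ a ∈ q, ∀ b ∈ q, ∃! p : List Atom,
      IsPath E p ∧ p.head? = some a ∧ p.getLast? = some b) ∧
  (∀ x : ℕ, ∀ F ∈ q, ∀ G ∈ q, x ∈ varsA F → x ∈ varsA G →
      ∀ p : List Atom, IsPath E p → p.head? = some F → p.getLast? = some G →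
        ∀ H ∈ p, x ∈ varsA H)

/-- The consecutive pairs (edges) of a path. -/
def edgePairs (p : List Atom) : List (Atom × Atom) := p.zip p.tail

/-- `F ↝ G` in the attack graph of the join tree `E` of `q`: `F ≠ G` are atoms
of `q`, and no label `vars(H) ∩ vars(H')` of an edge on the (unique) path from
`F` to `G` is contained in `F^{+,q}`. -/
def Attacks (S : Schema) (q : Finset Atom) (E : Atom → Atom → Prop) (F G : Atom) : Prop :=
  F ∈ q ∧ G ∈ q ∧ F ≠ G ∧
  ∀ p : List Atom, IsPath E p → p.head? = some F → p.getLast? = some G →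
    ∀ e ∈ edgePairs p, ¬ ((↑(varsA e.1 ∩ varsA e.2) : Set ℕ) ⊆ plusCl S q F)

/-- The attack `F ↝ G` is weak: `key(G) ⊆ F^{⊕,q}`. -/
def Weak (S : Schema) (q : Finset Atom) (F G : Atom) : Prop :=
  (↑(keyVars S G) : Set ℕ) ⊆ oplusCl S q F

/-- Consecutive pairs of a cyclic sequence, including the wrap-around pair. -/
def cyclePairs (L : List Atom) : List (Atom × Atom) := L.zip (L.rotate 1)

/-- `L` is an (elementary directed) cycle in the directed graph `att`. -/
def IsCycle (att : Atom → Atom → Prop) (L : List Atom) : Prop :=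
  2 ≤ L.length ∧ L.Nodup ∧ ∀ e ∈ cyclePairs L, att e.1 e.2

/-- A cycle is terminal: no edge leads from a vertex in the cycle to a vertex
outside the cycle. -/
def TerminalCycle (att : Atom → Atom → Prop) (L : List Atom) : Prop :=
  ∀ a ∈ L, ∀ b, att a b → b ∈ L

/-- A strong cycle in the attack graph: a cycle at least one attack of which is strong. -/
def StrongCycle (S : Schema) (q : Finset Atom) (E : Atom → Atom → Prop)
    (L : List Atom) : Prop :=
  IsCycle (Attacks S q E) L ∧ ∃ e ∈ cyclePairs L, ¬ Weak S q e.1 e.2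

/-- Substituting constant `c` for variable `z` in a term. -/
def substT (z c : ℕ) : Trm → Trm
  | Sum.inl v => if v = z then Sum.inr c else Sum.inl v
  | Sum.inr d => Sum.inr d

/-- `F[z→c]`. -/
def substA (z c : ℕ) (A : Atom) : Atom := ⟨A.rel, A.args.map (substT z c)⟩

/-- `q[z→c]`. -/
def substQ (z c : ℕ) (q : Finset Atom) : Finset Atom := q.image (substA z c)

/-- Simultaneous substitution of the constants `bs` for the (distinct)
variables `xs` (componentwise) in a term. -/
def substLT (xs bs : List ℕ) : Trm → Trm
  | Sum.inl v => if v ∈ xs then Sum.inr (bs.getD (xs.idxOf v) 0) else Sum.inl v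
  | Sum.inr d => Sum.inr d

/-- `F[x⃗→b⃗]`. -/
def substLA (xs bs : List ℕ) (A : Atom) : Atom := ⟨A.rel, A.args.map (substLT xs bs)⟩

/-- `q[x⃗→b⃗]`. -/
def substLQ (xs bs : List ℕ) (q : Finset Atom) : Finset Atom := q.image (substLA xs bs)

/-- First-order formulas over the relational vocabulary (relation names and
constants coded by naturals, variables coded by naturals). -/
inductive Fml where
  | atom (R : ℕ) (args : List Trm)
  | eq (s t : Trm)
  | tru
  | not (φ : Fml)
  | and (φ ψ : Fml)
  | or (φ ψ : Fml)
  | ex (v : ℕ) (φ : Fml)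
  | all (v : ℕ) (φ : Fml)

/-- Value of a term under an assignment of constants to variables. -/
def evalT (σ : ℕ → ℕ) : Trm → ℕ
  | Sum.inl v => σ v
  | Sum.inr c => c

/-- Satisfaction of a first-order formula in the finite structure whose
relations are given by the facts of `db`, with quantifiers ranging over `dom`. -/
def Holds (db : Finset Atom) (dom : Finset ℕ) : Fml → (ℕ → ℕ) → Prop
  | .atom R args, σ => (⟨R, args.map fun t => Sum.inr (evalT σ t)⟩ : Atom) ∈ db
  | .eq s t, σ => evalT σ s = evalT σ t
  | .tru, _ => True
  | .not φ, σ => ¬ Holds db dom φ σ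
  | .and φ ψ, σ => Holds db dom φ σ ∧ Holds db dom ψ σ
  | .or φ ψ, σ => Holds db dom φ σ ∨ Holds db dom ψ σ
  | .ex v φ, σ => ∃ a ∈ dom, Holds db dom φ (Function.update σ v a)
  | .all v φ, σ => ∀ a ∈ dom, Holds db dom φ (Function.update σ v a)

/-- Free variables of a formula. -/
def Fml.free : Fml → Finset ℕ
  | .atom _ args => varsL args
  | .eq s t => varsL [s, t]
  | .tru => ∅
  | .not φ => φ.free
  | .and φ ψ => φ.free ∪ ψ.free
  | .or φ ψ => φ.free ∪ ψ.free
  | .ex v φ => φ.free.erase v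
  | .all v φ => φ.free.erase v

/-- Relation names occurring in a formula. -/
def Fml.rels : Fml → Finset ℕ
  | .atom R _ => {R}
  | .eq _ _ => ∅
  | .tru => ∅
  | .not φ => φ.rels
  | .and φ ψ => φ.rels ∪ ψ.rels
  | .or φ ψ => φ.rels ∪ ψ.rels
  | .ex _ φ => φ.rels
  | .all _ φ => φ.rels

/-- Constants occurring in a formula. -/
def Fml.consts : Fml → Finset ℕ
  | .atom _ args => constsL args
  | .eq s t => constsL [s, t]
  | .tru => ∅
  | .not φ => φ.consts
  | .and φ ψ => φ.consts ∪ ψ.consts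
  | .or φ ψ => φ.consts ∪ ψ.consts
  | .ex _ φ => φ.consts
  | .all _ φ => φ.consts

/-- Well-formed formula: every atom has as many arguments as the arity of its
relation name. -/
def FmlWf (S : Schema) : Fml → Prop
  | .atom R args => args.length = S.arity R
  | .eq _ _ => True
  | .tru => True
  | .not φ => FmlWf S φ
  | .and φ ψ => FmlWf S φ ∧ FmlWf S ψ
  | .or φ ψ => FmlWf S φ ∧ FmlWf S ψ
  | .ex _ φ => FmlWf S φ
  | .all _ φ => FmlWf S φ

/-- The safety predicate of Dalvi, Ré and Suciu (rules SE1–SE4). -/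
inductive Safe (S : Schema) : Finset Atom → Prop
  | se1 (A : Atom) : isFact A → Safe S {A}
  | se2 (q₁ q₂ : Finset Atom) : q₁.Nonempty → q₂.Nonempty →
      Disjoint (varsQ q₁) (varsQ q₂) → Safe S q₁ → Safe S q₂ → Safe S (q₁ ∪ q₂)
  | se3 (q : Finset Atom) (x a : ℕ) : (∀ F ∈ q, x ∈ keyVars S F) →
      Safe S (substQ x a q) → Safe S q
  | se4 (q : Finset Atom) (F : Atom) (x a : ℕ) : F ∈ q → keyVars S F = ∅ →
      varsA F ≠ ∅ → x ∈ varsA F → Safe S (substQ x a q) → Safe S q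

/-- The atom `R_i(x_i ; x_{i+1})` (with `x_{k+1} = x_1`) of the query `acq_k`;
variable `x_i` is coded by `i`, relation name `R_i` by `i`. -/
def Ratom (k i : ℕ) : Atom := ⟨i, [Sum.inl i, Sum.inl (i % k + 1)]⟩

/-- The all-key atom `S_k(x_1,…,x_k)` of the query `acq_k`;
relation name `S_k` is coded by `0`. -/
def Satom (k : ℕ) : Atom := ⟨0, (List.range k).map (fun j => Sum.inl (j + 1))⟩

/-- The query `acq_k = {R_1(x_1;x_2), …, R_k(x_k;x_1), S_k(x_1,…,x_k)}`. -/
def acq (k : ℕ) : Finset Atom := ((Finset.Icc 1 k).image (Ratom k)) ∪ {Satom k}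

/-- Sum of `Pr` over the possible (= consistent) worlds of `db` satisfying `P`. -/
def prOf (S : Schema) (db : Finset Atom) (Pr : Finset Atom → ℚ)
    (P : Finset Atom → Prop) : ℚ :=
  ∑ w ∈ db.powerset.filter (fun w => Consistent S w ∧ P w), Pr w

end
lemma aux_mem_varsL (l : List Trm) (x : ℕ) : x ∈ varsL l ↔ Sum.inl x ∈ l := by
  simp [varsL, Sum.getLeft?_eq_some_iff]

lemma aux_varsL_subst (z c : ℕ) (l : List Trm) (x : ℕ) :
    x ∈ varsL (l.map (substT z c)) ↔ x ∈ varsL l ∧ x ≠ z := by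
  rw [aux_mem_varsL, aux_mem_varsL, List.mem_map]
  constructor
  · rintro ⟨t, ht, h⟩
    rcases t with v | d
    · by_cases hv : v = z
      · simp [substT, hv] at h
      · simp [substT, hv] at h
        subst h
        exact ⟨ht, hv⟩
    · simp [substT] at h
  · rintro ⟨h, hx⟩
    exact ⟨_, h, by simp [substT, hx]⟩

lemma aux_varsA_subst (z c : ℕ) (A : Atom) (x : ℕ) :
    x ∈ varsA (substA z c A) ↔ x ∈ varsA A ∧ x ≠ z := aux_varsL_subst z c A.args x

lemma aux_keyVars_subst (S : Schema) (z c : ℕ) (A : Atom) (x : ℕ) :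
    x ∈ keyVars S (substA z c A) ↔ x ∈ keyVars S A ∧ x ≠ z := by
  have := aux_varsL_subst z c (A.args.take (S.keyLen A.rel)) x
  simpa [keyVars, substA, List.map_take] using this

lemma aux_varsQ_subst (z c : ℕ) (q : Finset Atom) (x : ℕ) (hx : x ∈ varsQ q) (hxz : x ≠ z) :
    x ∈ varsQ (substQ z c q) := by
  simp only [varsQ, Finset.mem_biUnion, substQ, Finset.mem_image] at hx ⊢
  obtain ⟨A, hA, h⟩ := hx
  exact ⟨_, ⟨A, hA, rfl⟩, (aux_varsA_subst z c A x).2 ⟨h, hxz⟩⟩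

lemma aux_InCl (S : Schema) (z c : ℕ) (q q' : Finset Atom) (F : Atom)
    (hqq : ∀ A ∈ q, substA z c A ∈ q') (x : ℕ)
    (h : InCl (FDq S q) (keyVars S F) x) :
    x ≠ z → InCl (FDq S q') (keyVars S (substA z c F)) x := by
  induction h with
  | base h => exact fun hx => .base ((aux_keyVars_subst S z c F _).2 ⟨h, hx⟩)
  | step hZW _ hw ih =>
    intro hx
    obtain ⟨A, hA, h⟩ := hZW
    rw [Prod.mk.injEq] at h
    obtain ⟨rfl, rfl⟩ := h
    refine .step ⟨substA z c A, hqq A hA, rfl⟩ ?_ ((aux_varsA_subst z c A _).2 ⟨hw, hx⟩)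
    intro y hy
    rw [aux_keyVars_subst] at hy
    exact ih y hy.1 hy.2

lemma aux_path_map {E E' : Atom → Atom → Prop} {s : Set Atom} {f : Atom → Atom}
    (hinj : Set.InjOn f s) (hE : ∀ a b, E a b → E' (f a) (f b)) {p : List Atom}
    (hp : IsPath E p) (hs : ∀ a ∈ p, a ∈ s) : IsPath E' (p.map f) := by
  obtain ⟨h1, h2, h3⟩ := hp
  refine ⟨by simpa using h1, ?_, ?_⟩
  · exact List.Nodup.map_on (fun a ha b hb h => hinj (hs a ha) (hs b hb) h) h2
  · exact (List.isChain_map f).2 (h3.imp hE)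

lemma aux_path_mem {E : Atom → Atom → Prop} {s : Set Atom}
    (hE : ∀ a b, E a b → b ∈ s) (p : List Atom) : ∀ (a : Atom), a ∈ s →
    List.IsChain E p → p.head? = some a → ∀ b ∈ p, b ∈ s := by
  induction p with
  | nil => simp
  | cons x t ih =>
    intro a ha hc hh b hb
    simp only [List.head?_cons, Option.some.injEq] at hh
    subst hh
    rcases List.mem_cons.1 hb with rfl | hb
    · exact ha
    · cases t with
      | nil => simp at hb
      | cons y t =>
        rw [List.isChain_cons_cons] at hc
        exact ih y (hE _ _ hc.1) hc.2 rfl b hb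

/-- Substituting a constant `c` for a variable `z` in an acyclic
self-join-free query: (1) the substituted tree is a join tree for `q[z→c]`,
(2) attacks in the new attack graph come from attacks in the old one, and
(3) weak attacks stay weak. -/
theorem statement5 (S : Schema) (q : Finset Atom) (hq : ∀ F ∈ q, wfAtom S F)
    (hnsj : NoSelfJoin q) (E : Atom → Atom → Prop) (hjt : IsJoinTree q E)
    (F G : Atom) (hF : F ∈ q) (hG : G ∈ q)
    (z : ℕ) (hz : z ∈ varsQ q) (c : ℕ)
    (E' : Atom → Atom → Prop)
    (hE' : ∀ a b : Atom, E' a b ↔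
      ∃ a₀ b₀ : Atom, E a₀ b₀ ∧ a = substA z c a₀ ∧ b = substA z c b₀) :
    IsJoinTree (substQ z c q) E' ∧
    (Attacks S (substQ z c q) E' (substA z c F) (substA z c G) →
      Attacks S q E F G) ∧
    (Attacks S (substQ z c q) E' (substA z c F) (substA z c G) →
      Weak S q F G → Weak S (substQ z c q) (substA z c F) (substA z c G)) := by
  have hinj : Set.InjOn (substA z c) (q : Set Atom) := by
    intro A hA B hB h
    exact hnsj A hA B hB (by simpa [substA] using congrArg Atom.rel h)
  obtain ⟨hsym, hedge, huniq, hconn⟩ := hjt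
  have : Nonempty Atom := ⟨F⟩
  set f := substA z c with hf
  let g := Function.invFunOn f (q : Set Atom)
  have hgf : ∀ A ∈ q, g (f A) = A := fun A hA => hinj.leftInvOn_invFunOn hA
  have hmemq' : ∀ B, B ∈ substQ z c q ↔ ∃ A ∈ q, f A = B := by
    intro B; simp [substQ, hf]
  have hfg : ∀ B ∈ substQ z c q, f (g B) = B ∧ g B ∈ q := by
    intro B hB
    obtain ⟨A, hA, rfl⟩ := (hmemq' B).1 hB
    rw [hgf A hA]; exact ⟨rfl, hA⟩
  have hginj : Set.InjOn g (substQ z c q : Set Atom) := by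
    intro A hA B hB h
    rw [← (hfg A hA).1, ← (hfg B hB).1, h]
  have hEf : ∀ a b, E a b → E' (f a) (f b) := fun a b h => (hE' _ _).2 ⟨a, b, h, rfl, rfl⟩
  have hEg : ∀ a b, E' a b → E (g a) (g b) := by
    intro a b h
    obtain ⟨a0, b0, h0, rfl, rfl⟩ := (hE' _ _).1 h
    rw [hgf _ (hedge _ _ h0).1, hgf _ (hedge _ _ h0).2.1]
    exact h0
  have hedge' : ∀ a b, E' a b → a ∈ substQ z c q ∧ b ∈ substQ z c q ∧ a ≠ b := by
    intro a b h
    obtain ⟨a0, b0, h0, rfl, rfl⟩ := (hE' _ _).1 h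
    obtain ⟨ha, hb, hab⟩ := hedge _ _ h0
    exact ⟨(hmemq' _).2 ⟨_, ha, rfl⟩, (hmemq' _).2 ⟨_, hb, rfl⟩, fun h => hab (hinj ha hb h)⟩
  -- members of paths
  have hpm : ∀ p : List Atom, ∀ a ∈ q, IsPath E p → p.head? = some a → ∀ b ∈ p, b ∈ q :=
    fun p a ha hp hh => aux_path_mem (s := (q : Set Atom)) (fun a b h => (hedge a b h).2.1) p a ha
      hp.2.2 hh
  have hpm' : ∀ p : List Atom, ∀ a ∈ substQ z c q, IsPath E' p → p.head? = some a →
      ∀ b ∈ p, b ∈ substQ z c q :=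
    fun p a ha hp hh => aux_path_mem (s := (substQ z c q : Set Atom))
      (fun a b h => (hedge' a b h).2.1) p a ha hp.2.2 hh
  -- transport of paths
  have hdown : ∀ p : List Atom, ∀ a ∈ substQ z c q, ∀ b, IsPath E' p → p.head? = some a →
      p.getLast? = some b → IsPath E (p.map g) ∧ (p.map g).head? = some (g a) ∧
        (p.map g).getLast? = some (g b) ∧ (p.map g).map f = p := by
    intro p a ha b hp hh hl
    have hm := hpm' p a ha hp hh
    refine ⟨aux_path_map hginj hEg hp hm, by simp [hh], by simp [hl], ?_⟩
    rw [List.map_map]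
    conv_rhs => rw [← List.map_id p]
    exact List.map_congr_left fun B hB => (hfg B (hm B hB)).1
  have hup : ∀ p : List Atom, ∀ a ∈ q, ∀ b, IsPath E p → p.head? = some a →
      p.getLast? = some b → IsPath E' (p.map f) ∧ (p.map f).head? = some (f a) ∧
        (p.map f).getLast? = some (f b) := by
    intro p a ha b hp hh hl
    exact ⟨aux_path_map hinj hEf hp (hpm p a ha hp hh), by simp [hh], by simp [hl]⟩
  have hsubq : ∀ A ∈ q, f A ∈ substQ z c q := fun A hA => (hmemq' _).2 ⟨A, hA, rfl⟩
  refine ⟨⟨?_, hedge', ?_, ?_⟩, ?_, ?_⟩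
  · intro a b h
    obtain ⟨a0, b0, h0, rfl, rfl⟩ := (hE' _ _).1 h
    exact hEf _ _ (hsym _ _ h0)
  · intro a ha b hb
    obtain ⟨p, ⟨hp, hh, hl⟩, hu⟩ := huniq (g a) (hfg a ha).2 (g b) (hfg b hb).2
    refine ⟨p.map f, ?_, ?_⟩
    · have := hup p (g a) (hfg a ha).2 (g b) hp hh hl
      rwa [(hfg a ha).1, (hfg b hb).1] at this
    · rintro p' ⟨hp', hh', hl'⟩
      obtain ⟨h1, h2, h3, h4⟩ := hdown p' a ha b hp' hh' hl'
      rw [← h4, hu _ ⟨h1, h2, h3⟩]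
  · intro x A hA B hB hxA hxB p hp hh hl H hH
    obtain ⟨h1, h2, h3, h4⟩ := hdown p A hA B hp hh hl
    rw [← (hfg A hA).1, aux_varsA_subst] at hxA
    rw [← (hfg B hB).1, aux_varsA_subst] at hxB
    have := hconn x (g A) (hfg A hA).2 (g B) (hfg B hB).2 hxA.1 hxB.1 _ h1 h2 h3 (g H)
      (List.mem_map_of_mem hH)
    rw [← (hfg H (hpm' p A hA hp hh H hH)).1, aux_varsA_subst]
    exact ⟨this, hxA.2⟩
  · rintro ⟨-, -, hne, hat⟩
    refine ⟨hF, hG, fun h => hne (by rw [h]), ?_⟩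
    intro p hp hh hl e he hsub
    obtain ⟨h1, h2, h3⟩ := hup p F hF G hp hh hl
    refine hat _ h1 h2 h3 (f e.1, f e.2) ?_ ?_
    · have : edgePairs (p.map f) = (edgePairs p).map (Prod.map f f) := by
        simp only [edgePairs, ← List.map_tail, List.zip_map]
      rw [this]
      exact List.mem_map_of_mem he
    · intro x hx
      simp only [Finset.coe_inter, Set.mem_inter_iff, Finset.mem_coe] at hx
      rw [hf, aux_varsA_subst, aux_varsA_subst] at hx
      obtain ⟨hxq, hxc⟩ := hsub (show x ∈ (↑(varsA e.1 ∩ varsA e.2) : Set ℕ) by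
        simpa using ⟨hx.1.1, hx.2.1⟩)
      refine ⟨aux_varsQ_subst z c q x hxq hx.1.2, aux_InCl S z c _ _ F ?_ x hxc hx.1.2⟩
      intro A hA
      rw [Finset.mem_erase] at hA ⊢
      exact ⟨fun h => hA.1 (hinj hA.2 hF h), hsubq A hA.2⟩
  · rintro - hw x hx
    rw [Finset.mem_coe, hf, aux_keyVars_subst] at hx
    obtain ⟨hxq, hxc⟩ := hw (Finset.mem_coe.2 hx.1)
    exact ⟨aux_varsQ_subst z c q x hxq hx.2, aux_InCl S z c _ _ F hsubq x hxc hx.2⟩
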